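/- arXiv:2007.03335 — 5 statements merged into one kernel-verified Lean document; each statement's English description precedes it below -/
import Mathlib

section
/- Let d ≥ 2 and let l, g ∈ K[x,y] be linearly independent linear forms. Then the binary form l^{d−1}·g has Waring rank exactly d. -/
open MvPolynomial

/-- The Waring rank of a binary form `f` of degree `d`. -/
noncomputable def waringRank (K : Type*) [CommRing K] (d : ℕ)
    (f : MvPolynomial (Fin 2) K) : ℕ :=
  sInf {r : ℕ | ∃ l : Fin r → MvPolynomial (Fin 2) K,
    (∀ i, (l i).IsHomogeneous 1) ∧ f = ∑ i, l i ^ d}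

/-- A binary linear form is a linear combination of the two variables. -/
theorem MvPolynomial.IsHomogeneous.exists_eq_smul_X_add_smul_X {K : Type*} [CommRing K]
    {m : MvPolynomial (Fin 2) K} (hm : m.IsHomogeneous 1) :
    ∃ a b : K, m = a • X 0 + b • X 1 := by
  rw [← mem_homogeneousSubmodule, homogeneousSubmodule_one_eq_span_X,
    Submodule.mem_span_range_iff_exists_fun] at hm
  obtain ⟨c, rfl⟩ := hm
  exact ⟨c 0, c 1, by simp⟩

/-- Two linearly independent binary linear forms can be sent to `T` and `1` by an algebra
homomorphism to `K[T]` given by linear polynomials. -/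
theorem exists_aeval_eq_X_and_eq_one {K : Type*} [Field K]
    {l g : MvPolynomial (Fin 2) K} (hl : l.IsHomogeneous 1) (hg : g.IsHomogeneous 1)
    (hind : LinearIndependent K ![l, g]) :
    ∃ ψ : MvPolynomial (Fin 2) K →ₐ[K] Polynomial K, ψ l = Polynomial.X ∧ ψ g = 1 ∧
      ∀ m : MvPolynomial (Fin 2) K, m.IsHomogeneous 1 →
        ∃ a b : K, ψ m = Polynomial.C a * Polynomial.X + Polynomial.C b := by
  obtain ⟨p, q, rfl⟩ := hl.exists_eq_smul_X_add_smul_X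
  obtain ⟨r, s, rfl⟩ := hg.exists_eq_smul_X_add_smul_X
  have hdet : p * s - q * r ≠ 0 := by
    intro h
    rw [LinearIndependent.pair_iff] at hind
    have h₁ := hind s (-q) (by
      have : s • (p • X 0 + q • X 1) + (-q) • (r • X 0 + s • X 1)
          = (X 0 : MvPolynomial (Fin 2) K) * C (p * s - q * r) := by
        simp only [smul_eq_C_mul, map_sub, map_mul, map_neg]; ring
      rw [this, h, map_zero, mul_zero])
    have h₂ := hind r (-p) (by
      have : r • (p • X 0 + q • X 1) + (-p) • (r • X 0 + s • X 1)
          = -(X 1 : MvPolynomial (Fin 2) K) * C (p * s - q * r) := by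
        simp only [smul_eq_C_mul, map_sub, map_mul, map_neg]; ring
      rw [this, h, map_zero, mul_zero])
    have h₃ := hind 1 0 (by simp [neg_eq_zero.mp h₁.2, neg_eq_zero.mp h₂.2])
    exact one_ne_zero h₃.1
  set δ := p * s - q * r with hδ
  let u : Polynomial K := Polynomial.C (s / δ) * Polynomial.X + Polynomial.C (-q / δ)
  let v : Polynomial K := Polynomial.C (-r / δ) * Polynomial.X + Polynomial.C (p / δ)
  have key (a b : K) : aeval ![u, v] (a • X 0 + b • X 1 : MvPolynomial (Fin 2) K) =
      Polynomial.C ((a * s - b * r) / δ) * Polynomial.X + Polynomial.C ((b * p - a * q) / δ) := by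
    simp only [map_add, map_smul, aeval_X, Matrix.cons_val_zero, Matrix.cons_val_one,
      Polynomial.smul_eq_C_mul, u, v, sub_div, neg_div, map_sub, map_neg, mul_div_assoc, map_mul]
    ring
  refine ⟨aeval ![u, v], ?_, ?_, fun m hm ↦ ?_⟩
  · rw [key, ← hδ, div_self hdet, mul_comm q p, sub_self]
    simp
  · rw [key, mul_comm r s, sub_self, mul_comm s p, mul_comm r q, ← hδ, div_self hdet]
    simp
  · obtain ⟨a, b, rfl⟩ := hm.exists_eq_smul_X_add_smul_X
    exact ⟨_, _, key a b⟩

theorem Polynomial.coeff_C_mul_X_add_C_pow {K : Type*} [CommRing K] (a b : K) (d k : ℕ) :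
    ((C a * X + C b) ^ d).coeff k = a ^ k * b ^ (d - k) * d.choose k := by
  rw [show (C a * X + C b) ^ d = ((X + C b) ^ d).comp (C a * X) by simp, comp_C_mul_X_coeff,
    coeff_X_add_C_pow]
  ring

/-- The monomial `T ^ (d - 1)` is not a sum of fewer than `d` many `d`-th powers of polynomials
of degree at most one. -/
theorem Polynomial.le_of_X_pow_eq_sum_linear_pow {K : Type*} [Field K] [CharZero K]
    {d r : ℕ} (hd : 2 ≤ d) (a b : Fin r → K)
    (h : (X : Polynomial K) ^ (d - 1) = ∑ i, (C (a i) * X + C (b i)) ^ d) : d ≤ r := by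
  by_contra! hr
  classical
  let S : Finset (Fin r) := {i | b i ≠ 0}
  have hS : S.card ≤ d - 1 := (S.card_le_univ.trans (by simp)).trans (by omega : r ≤ d - 1)
  have moment (k : ℕ) (hk : k < d) :
      ∑ i ∈ S, b i ^ d * (a i / b i) ^ k = if k = d - 1 then (d : K)⁻¹ else 0 := by
    have hc := congrArg (fun p ↦ p.coeff k) h
    simp only [coeff_X_pow, finsetSum_coeff, coeff_C_mul_X_add_C_pow, ← Finset.sum_mul] at hc
    have hch : (d.choose k : K) ≠ 0 := by exact_mod_cast (Nat.choose_pos hk.le).ne'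
    have hsum : ∑ i ∈ S, b i ^ d * (a i / b i) ^ k = ∑ i, a i ^ k * b i ^ (d - k) := by
      rw [Finset.sum_filter]
      refine Finset.sum_congr rfl fun i _ ↦ ?_
      split_ifs with hb
      · rw [div_pow, ← Nat.sub_add_cancel hk.le, pow_add, Nat.sub_add_cancel hk.le]
        field_simp
      · rw [not_not.mp hb, zero_pow (by omega : d - k ≠ 0), mul_zero]
    rw [hsum]
    split_ifs at hc ⊢ with hkd
    · subst hkd
      rw [Nat.choose_symm (by omega : 1 ≤ d), Nat.choose_one_right] at hc
      exact eq_inv_of_mul_eq_one_left hc.symm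
    · exact (mul_eq_zero.mp hc.symm).resolve_right hch
  let P : Polynomial K := X ^ (d - 1 - S.card) * ∏ i ∈ S, (X - C (a i / b i))
  have hPm : P.Monic := (monic_X_pow _).mul (monic_prod_X_sub_C _ _)
  have hPd : P.natDegree = d - 1 := by
    rw [(monic_X_pow _).natDegree_mul (monic_prod_X_sub_C _ _), natDegree_X_pow,
      natDegree_finsetProd_X_sub_C_eq_card]
    omega
  have hPz : ∑ i ∈ S, b i ^ d * P.eval (a i / b i) = 0 := by
    refine Finset.sum_eq_zero fun i hi ↦ ?_
    rw [eval_mul, eval_prod, Finset.prod_eq_zero hi (by simp), mul_zero, mul_zero]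
  have hPe : ∑ i ∈ S, b i ^ d * P.eval (a i / b i) = (d : K)⁻¹ := by
    simp_rw [eval_eq_sum_range, hPd, Finset.mul_sum]
    rw [Finset.sum_comm, Nat.sub_add_cancel (by omega : 1 ≤ d)]
    simp_rw [mul_left_comm _ (P.coeff _), ← Finset.mul_sum]
    rw [Finset.sum_eq_single_of_mem (d - 1) (Finset.mem_range.mpr (by omega))]
    · rw [moment _ (by omega), if_pos rfl, ← hPd, hPm.coeff_natDegree, one_mul]
    · intro k hk hkd
      rw [moment _ (Finset.mem_range.mp hk), if_neg hkd, mul_zero]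
  exact inv_ne_zero (by exact_mod_cast (by omega : d ≠ 0) : (d : K) ≠ 0) (hPe.symm.trans hPz)

/-- Averaging over the `d`-th roots of unity extracts `x ^ (d - 1) * y` from `(x + y) ^ d`. -/
theorem IsPrimitiveRoot.sum_mul_add_pow {R : Type*} [CommRing R] [IsDomain R] {d : ℕ}
    (hd : 2 ≤ d) {ζ : R} (hζ : IsPrimitiveRoot ζ d) {A : Type*} [CommRing A] [Algebra R A]
    (x y : A) :
    ∑ i ∈ Finset.range d, ζ ^ i • (ζ ^ i • x + y) ^ d = (d ^ 2 : A) * (x ^ (d - 1) * y) := by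
  have hsum (k : ℕ) (hk : k ≤ d) :
      ∑ i ∈ Finset.range d, ζ ^ i * (ζ ^ i) ^ k = if k = d - 1 then (d : R) else 0 := by
    have hre : ∑ i ∈ Finset.range d, ζ ^ i * (ζ ^ i) ^ k =
        ∑ i ∈ Finset.range d, (ζ ^ (k + 1)) ^ i :=
      Finset.sum_congr rfl fun i _ ↦ by ring
    rw [hre]
    split_ifs with hkd
    · rw [hkd, Nat.sub_add_cancel (by omega : 1 ≤ d), hζ.pow_eq_one]
      simp
    · have hne : ζ ^ (k + 1) ≠ 1 := by
        rw [Ne, hζ.pow_eq_one_iff_dvd]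
        rintro ⟨c, hc⟩
        have : c < 2 := by by_contra! h; nlinarith
        interval_cases c <;> omega
      refine eq_zero_of_ne_zero_of_mul_left_eq_zero (sub_ne_zero.mpr hne) ?_
      rw [mul_geom_sum, pow_right_comm, hζ.pow_eq_one, one_pow, sub_self]
  simp_rw [add_pow, Finset.smul_sum, smul_pow]
  rw [Finset.sum_comm]
  have hterm (k : ℕ) (hk : k ∈ Finset.range (d + 1)) :
      ∑ i ∈ Finset.range d, ζ ^ i • ((ζ ^ i) ^ k • x ^ k * y ^ (d - k) * (d.choose k : A)) =
        (if k = d - 1 then (d : R) else 0) • (x ^ k * y ^ (d - k) * (d.choose k : A)) := by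
    rw [← hsum k (Nat.lt_succ_iff.mp (Finset.mem_range.mp hk)), Finset.sum_smul]
    exact Finset.sum_congr rfl fun i _ ↦ by rw [smul_mul_assoc, smul_mul_assoc, smul_smul]
  rw [Finset.sum_congr rfl hterm,
    Finset.sum_eq_single_of_mem (d - 1) (Finset.mem_range.mpr (by omega))
      fun k _ hk ↦ by rw [if_neg hk, zero_smul]]
  rw [if_pos rfl, Nat.choose_symm (by omega : 1 ≤ d), Nat.choose_one_right,
    (by omega : d - (d - 1) = 1), pow_one, Nat.cast_smul_eq_nsmul, nsmul_eq_mul]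
  ring

/-- For `d ≥ 2` and linearly independent linear forms `l, g`, the binary form
`l^(d-1) * g` has Waring rank exactly `d`. -/
theorem waringRank_pow_mul {K : Type*} [Field K] [IsAlgClosed K] [CharZero K]
    (d : ℕ) (hd : 2 ≤ d)
    (l g : MvPolynomial (Fin 2) K)
    (hl : l.IsHomogeneous 1) (hg : g.IsHomogeneous 1)
    (hind : LinearIndependent K ![l, g]) :
    waringRank K d (l ^ (d - 1) * g) = d := by
  have hd₀ : (d : K) ≠ 0 := by exact_mod_cast (by omega : d ≠ 0)
  refine IsLeast.csInf_eq ⟨?_, ?_⟩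
  · have : NeZero (d : K) := ⟨hd₀⟩
    obtain ⟨ζ, hζ⟩ := (HasEnoughRootsOfUnity.exists_primitiveRoot K d)
    choose c hc using fun i : ℕ ↦
      IsAlgClosed.exists_pow_nat_eq (((d : K) ^ 2)⁻¹ * ζ ^ i) (by omega : 0 < d)
    have smul_hom {m : MvPolynomial (Fin 2) K} (a : K) (hm : m.IsHomogeneous 1) :
        (a • m).IsHomogeneous 1 := (homogeneousSubmodule (Fin 2) K 1).smul_mem a hm
    refine ⟨fun i ↦ c i • (ζ ^ (i : ℕ) • l + g), fun i ↦ smul_hom _ ((smul_hom _ hl).add hg), ?_⟩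
    simp_rw [smul_pow, hc]
    rw [Fin.sum_univ_eq_sum_range (fun i ↦ (((d : K) ^ 2)⁻¹ * ζ ^ i) • (ζ ^ i • l + g) ^ d)]
    simp_rw [mul_smul]
    rw [← Finset.smul_sum, hζ.sum_mul_add_pow hd, eq_inv_smul_iff₀ (pow_ne_zero 2 hd₀),
      smul_eq_C_mul, map_pow, map_natCast]
  · rintro r ⟨m, hm, h⟩
    obtain ⟨ψ, hψl, hψg, hψ⟩ := exists_aeval_eq_X_and_eq_one hl hg hind
    choose a b hab using fun i ↦ hψ (m i) (hm i)
    refine Polynomial.le_of_X_pow_eq_sum_linear_pow hd a b ?_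
    have := congrArg ψ h
    simpa [hψl, hψg, hab] using this
end

section
/- Every nonzero binary form f of degree d ≥ 1 over K has Waring rank at most d; that is, f can always be written as a sum of at most d d-th powers of linear forms. -/
open MvPolynomial

/-- If `h` is separable and `deg h < deg g`, some member `g + s h` of the pencil is separable. -/
theorem exists_separable_add_C_mul {K : Type*} [Field K] [IsAlgClosed K] [CharZero K]
    {g h : Polynomial K} (hh : h.Separable) (hdeg : h.natDegree < g.natDegree) :
    ∃ s : K, (g + Polynomial.C s * h).Separable := by
  classical
  set W : Polynomial K := g.derivative * h - g * h.derivative with hW_def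
  have hW : W ≠ 0 := by
    intro h0
    have hdvd : h ∣ g * h.derivative := ⟨g.derivative, by linear_combination -h0⟩
    obtain ⟨k, rfl⟩ := IsCoprime.dvd_of_dvd_mul_right hh hdvd
    have hk : h * h * k.derivative = 0 := by
      rw [← h0, hW_def, Polynomial.derivative_mul]
      ring
    have hk0 : k.derivative = 0 := by simpa [hh.ne_zero] using hk
    have hk1 := Polynomial.derivative_eq_zero.1 hk0
    have := Polynomial.natDegree_mul_le (p := h) (q := k)
    omega
  obtain ⟨s, hs⟩ := Infinite.exists_notMem_finset
    (W.roots.toFinset.image (fun x => -(g.eval x / h.eval x)) ∪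
      W.roots.toFinset.image (fun x => -(g.derivative.eval x / h.derivative.eval x)))
  refine ⟨s, ?_⟩
  by_contra hsep
  rw [Polynomial.Separable, Polynomial.isCoprime_iff_aeval_ne_zero_of_isAlgClosed K K] at hsep
  push Not at hsep
  obtain ⟨x, hx, hx'⟩ := hsep
  simp only [Polynomial.coe_aeval_eq_eval, Polynomial.derivative_add,
    Polynomial.derivative_C_mul, Polynomial.eval_add, Polynomial.eval_mul,
    Polynomial.eval_C] at hx hx'
  have hWx : x ∈ W.roots.toFinset := by
    rw [Multiset.mem_toFinset, Polynomial.mem_roots hW, Polynomial.IsRoot, hW_def]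
    simp only [Polynomial.eval_sub, Polynomial.eval_mul]
    linear_combination h.eval x * hx' - h.derivative.eval x * hx
  apply hs
  rw [Finset.mem_union, Finset.mem_image, Finset.mem_image]
  by_cases hhx : h.eval x = 0
  · have hhx' : h.derivative.eval x ≠ 0 := by
      simpa using hh.eval₂_derivative_ne_zero (RingHom.id K) (by simpa using hhx)
    right
    refine ⟨x, hWx, ?_⟩
    field_simp
    linear_combination -hx'
  · left
    refine ⟨x, hWx, ?_⟩
    field_simp
    linear_combination -hx

/-- A linear functional on polynomials kills a monic separable polynomial of degree `d`, unless
`X ^ d` is the only monomial of degree at most `d` on which it does not vanish. -/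
theorem exists_monic_separable_mem_ker {K : Type*} [Field K] [IsAlgClosed K] [CharZero K]
    (L : Polynomial K →ₗ[K] K) (d : ℕ)
    (hL : (∀ j < d, L (Polynomial.X ^ j) = 0) → L (Polynomial.X ^ d) = 0) :
    ∃ p : Polynomial K, p.Monic ∧ p.natDegree = d ∧ p.Separable ∧ L p = 0 := by
  have pencil : ∀ (n : ℕ) (g h : Polynomial K), g.Monic → g.natDegree = n → h.Separable →
      h.natDegree < n → L g = 0 → L h = 0 →
      ∃ p : Polynomial K, p.Monic ∧ p.natDegree = n ∧ p.Separable ∧ L p = 0 := by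
    intro n g h hg hgn hh hhn hLg hLh
    obtain ⟨s, hs⟩ := exists_separable_add_C_mul hh (hgn ▸ hhn)
    have hlt : (Polynomial.C s * h).natDegree < g.natDegree :=
      (Polynomial.natDegree_C_mul_le s h).trans_lt (hgn ▸ hhn)
    refine ⟨_, hg.add_of_left (Polynomial.degree_lt_degree hlt), ?_, hs, ?_⟩
    · rw [Polynomial.natDegree_add_eq_left_of_natDegree_lt hlt, hgn]
    · rw [map_add, hLg, ← Polynomial.smul_eq_C_mul, map_smul, hLh, smul_zero, add_zero]
  induction d with
  | zero =>
    exact ⟨1, Polynomial.monic_one, Polynomial.natDegree_one, Polynomial.separable_one,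
      by simpa using hL⟩
  | succ d ih =>
    have hg : ∃ g : Polynomial K, g.Monic ∧ g.natDegree = d + 1 ∧ L g = 0 := by
      by_cases h0 : ∀ j < d + 1, L (Polynomial.X ^ j) = 0
      · exact ⟨Polynomial.X ^ (d + 1), Polynomial.monic_X_pow _, Polynomial.natDegree_X_pow _,
          hL h0⟩
      · push Not at h0
        obtain ⟨j, hj, hLj⟩ := h0
        set c : K := -(L (Polynomial.X ^ (d + 1)) / L (Polynomial.X ^ j)) with hc
        have hlt : (Polynomial.C c * Polynomial.X ^ j : Polynomial K).natDegree <
            (Polynomial.X ^ (d + 1) : Polynomial K).natDegree := by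
          rw [Polynomial.natDegree_X_pow]
          exact (Polynomial.natDegree_C_mul_X_pow_le c j).trans_lt hj
        refine ⟨Polynomial.X ^ (d + 1) + Polynomial.C c * Polynomial.X ^ j,
          (Polynomial.monic_X_pow _).add_of_left (Polynomial.degree_lt_degree hlt), ?_, ?_⟩
        · rw [Polynomial.natDegree_add_eq_left_of_natDegree_lt hlt, Polynomial.natDegree_X_pow]
        · rw [map_add, ← Polynomial.smul_eq_C_mul, map_smul, smul_eq_mul, hc]
          field_simp
          ring
    obtain ⟨g, hgm, hgd, hLg⟩ := hg
    by_cases hd : (∀ j < d, L (Polynomial.X ^ j) = 0) → L (Polynomial.X ^ d) = 0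
    · obtain ⟨h, -, hhd, hhs, hLh⟩ := ih hd
      exact pencil _ g h hgm hgd hhs (by omega) hLg hLh
    · push Not at hd
      rcases Nat.eq_zero_or_pos d with rfl | hpos
      · exact ⟨g, hgm, hgd,
          hgm.eq_X_add_C hgd ▸ Polynomial.separable_X_add_C (g.coeff 0), hLg⟩
      · exact pencil _ g 1 hgm hgd Polynomial.separable_one (by simp) hLg
          (by simpa using hd.1 0 hpos)

/-- A linear functional killing a monic separable polynomial `p` agrees, on polynomials of degree
at most `deg p`, with a combination of evaluations at the roots of `p`. -/
theorem exists_eq_sum_eval_of_separable {K : Type*} [Field K] [IsAlgClosed K]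
    (L : Polynomial K →ₗ[K] K) {p : Polynomial K} (hm : p.Monic) (hs : p.Separable)
    (hp : L p = 0) :
    ∃ (t : Finset K) (c : K → K), t.card = p.natDegree ∧
      ∀ j ≤ p.natDegree, L (Polynomial.X ^ j) = ∑ x ∈ t, c x * x ^ j := by
  classical
  have hcard : p.roots.toFinset.card = p.natDegree := by
    rw [Multiset.toFinset_card_of_nodup (Polynomial.nodup_roots hs),
      (IsAlgClosed.splits p).natDegree_eq_card_roots]
  set t := p.roots.toFinset with ht
  have hroot : ∀ x ∈ t, p.eval x = 0 := fun x hx => by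
    rw [ht, Multiset.mem_toFinset] at hx
    exact (Polynomial.mem_roots'.1 hx).2
  have key : ∀ q : Polynomial K, q.degree < p.degree →
      L q = ∑ x ∈ t, L (Lagrange.basis t id x) * q.eval x := by
    intro q hq
    have hq' : q.degree < (t.card : WithBot ℕ) := by
      rwa [hcard, ← Polynomial.degree_eq_natDegree hm.ne_zero]
    conv_lhs => rw [Lagrange.eq_interpolate (v := id) (Set.injOn_id _) hq']
    rw [Lagrange.interpolate_apply, map_sum]
    refine Finset.sum_congr rfl fun x _ => ?_
    rw [← Polynomial.smul_eq_C_mul, map_smul, smul_eq_mul, mul_comm, id]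
  refine ⟨t, fun x => L (Lagrange.basis t id x), hcard, fun j hj => ?_⟩
  rcases hj.lt_or_eq with hj | rfl
  · rw [key _ (by rw [Polynomial.degree_X_pow, Polynomial.degree_eq_natDegree hm.ne_zero]
                  exact_mod_cast hj)]
    simp
  · have hlt : (Polynomial.X ^ p.natDegree - p).degree < p.degree := by
      have hdeg : (Polynomial.X ^ p.natDegree : Polynomial K).degree = p.degree := by
        rw [Polynomial.degree_X_pow, Polynomial.degree_eq_natDegree hm.ne_zero]
      rw [← hdeg]
      exact Polynomial.degree_sub_lt_left hdeg (pow_ne_zero _ Polynomial.X_ne_zero)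
        (by rw [(Polynomial.monic_X_pow _).leadingCoeff, hm.leadingCoeff])
    have := key _ hlt
    rw [map_sub, hp, sub_zero] at this
    rw [this]
    refine Finset.sum_congr rfl fun x hx => ?_
    simp [hroot x hx]

/-- A binary form of degree `d` is a combination of the monomials `x ^ (d - j) * y ^ j`. -/
theorem MvPolynomial.IsHomogeneous.exists_eq_sum_binary {R : Type*} [CommSemiring R] {d : ℕ}
    {f : MvPolynomial (Fin 2) R} (hf : f.IsHomogeneous d) :
    ∃ b : ℕ → R, f = ∑ j ∈ Finset.range (d + 1), C (b j) * (X 0 ^ (d - j) * X 1 ^ j) := by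
  classical
  refine ⟨fun j => f.coeff (Finsupp.single 0 (d - j) + Finsupp.single 1 j), ?_⟩
  have hmon : ∀ j (r : R), (C r * (X 0 ^ (d - j) * X 1 ^ j) : MvPolynomial (Fin 2) R) =
      monomial (Finsupp.single 0 (d - j) + Finsupp.single 1 j) r := by
    intro j r
    simp [X_pow_eq_monomial, monomial_mul, C_mul_monomial]
  simp only [hmon]
  ext m
  simp only [coeff_sum, coeff_monomial]
  by_cases hm : m.degree = d
  · have hm2 : m 0 + m 1 = d := by
      rw [← hm, Finsupp.degree_eq_sum, Fin.sum_univ_two]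
    have hmeq : Finsupp.single 0 (d - m 1) + Finsupp.single 1 (m 1) = m := by
      ext i
      fin_cases i
      · simp; omega
      · simp
    rw [Finset.sum_eq_single (m 1)]
    · rw [if_pos hmeq, hmeq]
    · intro j _ hj
      rw [if_neg]
      rintro rfl
      simp at hj
    · intro h
      exact absurd (Finset.mem_range.2 (by omega)) h
  · rw [hf.coeff_eq_zero hm]
    refine (Finset.sum_eq_zero fun j hj => if_neg ?_).symm
    rintro rfl
    apply hm
    have := Finset.mem_range.1 hj
    simp [Finsupp.degree_eq_sum, Fin.sum_univ_two]
    omega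

theorem waringRank_le_card {K ι : Type*} [CommRing K] {d : ℕ} {f : MvPolynomial (Fin 2) K}
    (s : Finset ι) (l : ι → MvPolynomial (Fin 2) K) (hl : ∀ i ∈ s, (l i).IsHomogeneous 1)
    (hf : f = ∑ i ∈ s, l i ^ d) : waringRank K d f ≤ s.card := by
  refine Nat.sInf_le ⟨fun i => l (s.equivFin.symm i), fun i => hl _ (s.equivFin.symm i).2, ?_⟩
  rw [hf, ← Finset.sum_coe_sort]
  exact (Equiv.sum_comp s.equivFin.symm (fun i : s => l i ^ d)).symm

/-- Every nonzero binary form of degree `d ≥ 1` has Waring rank at most `d`. -/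
theorem waringRank_le_degree {K : Type*} [Field K] [IsAlgClosed K] [CharZero K]
    (d : ℕ) (hd : 1 ≤ d)
    (f : MvPolynomial (Fin 2) K) (hf0 : f ≠ 0) (hf : f.IsHomogeneous d) :
    waringRank K d f ≤ d := by
  obtain ⟨b, hb⟩ := hf.exists_eq_sum_binary
  choose γ hγ using fun c : K => IsAlgClosed.exists_pow_nat_eq c hd
  have hchoose : ∀ j ≤ d, (d.choose j : K) ≠ 0 := fun j hj =>
    Nat.cast_ne_zero.2 (Nat.choose_pos hj).ne'
  let L : Polynomial K →ₗ[K] K :=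
    (Polynomial.basisMonomials K).constr K fun j => b j / d.choose j
  have hLX : ∀ j, L (Polynomial.X ^ j) = b j / d.choose j := fun j => by
    simpa [Polynomial.X_pow_eq_monomial] using
      (Polynomial.basisMonomials K).constr_basis K (fun j => b j / (d.choose j : K)) j
  by_cases hL : (∀ j < d, L (Polynomial.X ^ j) = 0) → L (Polynomial.X ^ d) = 0
  · obtain ⟨p, hpm, rfl, hps, hLp⟩ := exists_monic_separable_mem_ker L d hL
    obtain ⟨t, c, ht, hc⟩ := exists_eq_sum_eval_of_separable L hpm hps hLp
    set d := p.natDegree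
    refine (waringRank_le_card t (fun x => C (γ (c x)) * (C x * X 1 + X 0)) ?_ ?_).trans ht.le
    · intro x _
      exact (((isHomogeneous_X K (1 : Fin 2)).C_mul x).add (isHomogeneous_X K 0)).C_mul _
    · have hpow : ∀ x, (C (γ (c x)) * (C x * X 1 + X 0) : MvPolynomial (Fin 2) K) ^ d =
          ∑ j ∈ Finset.range (d + 1),
            C (c x * x ^ j) * C (d.choose j : K) * (X 0 ^ (d - j) * X 1 ^ j) := by
        intro x
        rw [mul_pow, ← C_pow, hγ, add_pow, Finset.mul_sum]
        refine Finset.sum_congr rfl fun j _ => ?_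
        simp only [map_mul, map_pow, map_natCast, mul_pow]
        ring
      simp only [hpow]
      rw [Finset.sum_comm, hb]
      refine Finset.sum_congr rfl fun j hj => ?_
      have hj' : j ≤ d := Nat.lt_succ_iff.1 (Finset.mem_range.1 hj)
      rw [← Finset.sum_mul, ← Finset.sum_mul, ← map_sum, ← hc j hj', hLX, ← C_mul,
        div_mul_cancel₀ _ (hchoose j hj')]
  · push Not at hL
    refine (waringRank_le_card {()} (fun _ => C (γ (b d)) * X 1) ?_ ?_).trans hd
    · intro _ _
      exact (isHomogeneous_X K 1).C_mul _
    · rw [Finset.sum_singleton, mul_pow, ← C_pow, hγ, hb, Finset.sum_range_succ,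
        Finset.sum_eq_zero]
      · simp
      · intro j hj
        have hj' := Finset.mem_range.1 hj
        have := hL.1 j hj'
        rw [hLX, div_eq_zero_iff, or_iff_left (hchoose j hj'.le)] at this
        rw [this, C_0, zero_mul]
end

section
/- Let d and k be integers with d ≥ 2k+2 and k ≥ 0. Let l₀, l₁, …, l_k ∈ K[x,y] be pairwise non-proportional nonzero linear forms, and let g be a linear form not proportional to l₀. Then the K-vector space spanned by the 2k+4 binary forms { x·l_i^{d−1}, y·l_i^{d−1} : 0 ≤ i ≤ k } ∪ { x·l₀^{d−2}·g, y·l₀^{d−2}·g } inside the space of degree-d binary forms has dimension exactly 2k+3. (This is the tangent-space computation at a general point f = l₀^{d−1}g + l₁^d + ⋯ + l_k^d in the proof of Theorem 4.) -/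
open MvPolynomial

theorem Derivation.eq_zero_of_dvd_of_apply_eq_zero {K A : Type*} [Field K] [CharZero K]
    [CommRing A] [IsDomain A] [WfDvdMonoid A] [Algebra K A] (D : Derivation K A A)
    {p f : A} {c : K} (hp : ¬IsUnit p) (hDp : D p = algebraMap K A c) (hc : c ≠ 0)
    (hdvd : p ∣ f) (hf : D f = 0) : f = 0 := by
  by_contra hf0
  have hfin := FiniteMultiplicity.of_not_isUnit hp hf0
  obtain ⟨q, hq, hndvd⟩ := hfin.exists_eq_pow_mul_and_not_dvd
  obtain ⟨e, he⟩ : ∃ e, multiplicity p f = e + 1 :=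
    Nat.exists_eq_succ_of_ne_zero fun h ↦ by
      rw [h, pow_zero, one_mul] at hq
      exact hndvd (hq ▸ hdvd)
  rw [he] at hq
  have hp0 : p ≠ 0 := by
    rintro rfl
    exact hf0 (zero_dvd_iff.mp hdvd)
  have hu : IsUnit (algebraMap K A ((e + 1 : ℕ) * c)) :=
    (IsUnit.mk0 _ (mul_ne_zero (Nat.cast_ne_zero.mpr e.succ_ne_zero) hc)).map _
  have hD : p ^ e * (p * D q + algebraMap K A ((e + 1 : ℕ) * c) * q) = 0 := by
    rw [← hf, hq, D.leibniz, D.leibniz_pow, hDp]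
    simp only [Nat.add_sub_cancel, smul_eq_mul, nsmul_eq_mul]
    rw [map_mul, _root_.map_natCast]
    ring
  have hsum := (mul_eq_zero.mp hD).resolve_left (pow_ne_zero e hp0)
  have h : p ∣ algebraMap K A ((e + 1 : ℕ) * c) * q :=
    ⟨-D q, by linear_combination hsum⟩
  exact hndvd (hu.dvd_mul_left.mp h)

theorem Derivation.pow_dvd_apply_of_pow_succ_dvd {K A : Type*} [CommSemiring K] [CommSemiring A]
    [Algebra K A] (D : Derivation K A A) {p f : A} {e : ℕ} (h : p ^ (e + 1) ∣ f) :
    p ^ e ∣ D f := by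
  obtain ⟨q, rfl⟩ := h
  rw [D.leibniz, D.leibniz_pow, Nat.add_sub_cancel]
  simp only [smul_eq_mul, nsmul_eq_mul]
  refine dvd_add (Dvd.intro (p * D q) (by ring)) ?_
  exact Dvd.intro (q * ((e + 1 : ℕ) * D p)) (by ring)

theorem Derivation.eq_zero_of_pow_dvd_of_prod_apply_eq_zero {K A ι : Type*} [Field K] [CharZero K]
    [CommRing A] [IsDomain A] [WfDvdMonoid A] [Algebra K A] (D : ι → Derivation K A A)
    {p : A} (hp : ¬IsUnit p) (L : List ι)
    (hD : ∀ i ∈ L, ∃ c : K, c ≠ 0 ∧ D i p = algebraMap K A c) {f : A}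
    (hdvd : p ^ L.length ∣ f)
    (hf : (L.map fun i ↦ (D i : Module.End K A)).prod f = 0) : f = 0 := by
  suffices h : ∀ e, p ^ (e + L.length) ∣ f →
      p ^ e ∣ (L.map fun i ↦ (D i : Module.End K A)).prod f ∧
      ((L.map fun i ↦ (D i : Module.End K A)).prod f = 0 → f = 0) from
    (h 0 (by simpa using hdvd)).2 hf
  clear hdvd hf
  induction L with
  | nil => intro e he; simpa using he
  | cons i L ih =>
    intro e he
    obtain ⟨h₁, h₂⟩ := ih (fun j hj ↦ hD j (List.mem_cons_of_mem i hj)) (e + 1)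
      (by convert he using 2; simp; omega)
    obtain ⟨c, hc, hDp⟩ := hD i List.mem_cons_self
    simp only [List.map_cons, List.prod_cons, Module.End.mul_apply]
    refine ⟨(D i).pow_dvd_apply_of_pow_succ_dvd h₁, fun h ↦ h₂ ?_⟩
    exact (D i).eq_zero_of_dvd_of_apply_eq_zero hp hDp hc
      ((dvd_pow_self p e.succ_ne_zero).trans h₁) h

theorem List.prod_apply_eq_zero_of_mem {R M : Type*} [Semiring R] [AddCommMonoid M] [Module R M]
    {L : List (Module.End R M)} {T : Module.End R M} (hT : T ∈ L)
    (hcomm : ∀ S ∈ L, Commute T S) {x : M} (hx : T x = 0) : L.prod x = 0 := by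
  induction L with
  | nil => simp at hT
  | cons S L ih =>
    rw [List.prod_cons]
    by_cases h : T ∈ L
    · rw [Module.End.mul_apply, ih h fun S hS ↦ hcomm S (List.mem_cons_of_mem _ hS), map_zero]
    · obtain rfl : T = S := by simpa [h] using hT
      rw [(Commute.list_prod_right L T fun S hS ↦ hcomm S (List.mem_cons_of_mem _ hS)).eq,
        Module.End.mul_apply, hx, map_zero]

namespace MvPolynomial

theorem finrank_homogeneousSubmodule_fin_two (K : Type*) [Field K] (n : ℕ) :
    Module.finrank K (homogeneousSubmodule (Fin 2) K n) = n + 1 := by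
  have h : homogeneousSubmodule (Fin 2) K n =
      restrictSupport K {d : Fin 2 →₀ ℕ | d.degree = n} :=
    homogeneousSubmodule_eq_finsupp_supported _ _ n
  have hs : {d : Fin 2 →₀ ℕ | d.degree = n} =
      ((Finset.univ : Finset (Fin 2)).finsuppAntidiag n : Set (Fin 2 →₀ ℕ)) := by
    ext d
    simp [Finsupp.degree_eq_sum]
  rw [h, Module.finrank_eq_nat_card_basis (basisRestrictSupport K _), hs,
    Nat.card_coe_set_eq, Set.ncard_coe_finset, Finset.card_finsuppAntidiag_nat_eq_choose]
  simp [add_comm]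

theorem IsHomogeneous.exists_eq_X_add_X {K : Type*} [CommSemiring K] {p : MvPolynomial (Fin 2) K}
    (hp : p.IsHomogeneous 1) : ∃ a b : K, p = C a * X 0 + C b * X 1 := by
  have h : p ∈ homogeneousSubmodule (Fin 2) K 1 := hp
  rw [homogeneousSubmodule_one_eq_span_X, Submodule.mem_span_range_iff_exists_fun] at h
  obtain ⟨c, rfl⟩ := h
  exact ⟨c 0, c 1, by simp [Fin.sum_univ_two, smul_eq_C_mul]⟩

section AnnihilatingDerivation

variable {K : Type*} [CommRing K]

/-- The constant-coefficient derivation annihilating the linear form `a x + b y`. -/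
noncomputable def annihilatingDerivation (a b : K) :
    Derivation K (MvPolynomial (Fin 2) K) (MvPolynomial (Fin 2) K) :=
  b • pderiv 0 - a • pderiv 1

theorem annihilatingDerivation_linear (a b c e : K) :
    annihilatingDerivation a b (C c * X 0 + C e * X 1) = algebraMap K _ (b * c - a * e) := by
  simp [annihilatingDerivation, pderiv_X, smul_eq_C_mul, algebraMap_eq]

theorem commute_annihilatingDerivation (a b c e : K) :
    Commute (annihilatingDerivation a b : Module.End K (MvPolynomial (Fin 2) K))
      (annihilatingDerivation c e) := by
  have h : ⁅annihilatingDerivation a b, annihilatingDerivation c e⁆ = 0 :=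
    derivation_ext fun i ↦ by
      fin_cases i <;>
        simp [Derivation.commutator_apply, annihilatingDerivation, pderiv_X, smul_eq_C_mul]
  refine LinearMap.ext fun f ↦ sub_eq_zero.mp ?_
  simpa [Derivation.commutator_apply] using DFunLike.congr_fun h f

theorem IsHomogeneous.annihilatingDerivation {p : MvPolynomial (Fin 2) K} {n : ℕ}
    (hp : p.IsHomogeneous n) (a b : K) :
    (annihilatingDerivation a b p).IsHomogeneous (n - 1) := by
  have h (i : Fin 2) : pderiv i p ∈ homogeneousSubmodule (Fin 2) K (n - 1) := hp.pderiv
  exact Submodule.sub_mem _ (Submodule.smul_mem _ b (h 0)) (Submodule.smul_mem _ a (h 1))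

theorem IsHomogeneous.annihilatingDerivation_pow_apply_eq_zero {p : MvPolynomial (Fin 2) K} {n : ℕ}
    (hp : p.IsHomogeneous n) (a b : K) :
    ((MvPolynomial.annihilatingDerivation a b : Module.End K _) ^ (n + 1)) p = 0 := by
  induction n generalizing p with
  | zero =>
    obtain ⟨c, rfl⟩ : ∃ c, C c = p :=
      ⟨_, (totalDegree_eq_zero_iff_eq_C.mp (Nat.le_zero.mp hp.totalDegree_le)).symm⟩
    simp [MvPolynomial.annihilatingDerivation]
  | succ n ih =>
    rw [pow_succ, Module.End.mul_apply]
    exact ih (hp.annihilatingDerivation a b)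

theorem annihilatingDerivation_pow_pow_mul (a b : K) (e n : ℕ) (p : MvPolynomial (Fin 2) K) :
    ((annihilatingDerivation a b : Module.End K _) ^ n) ((C a * X 0 + C b * X 1) ^ e * p) =
      (C a * X 0 + C b * X 1) ^ e * ((annihilatingDerivation a b : Module.End K _) ^ n) p := by
  induction n generalizing p with
  | zero => simp
  | succ n ih =>
    have h : annihilatingDerivation a b (C a * X 0 + C b * X 1) = 0 := by
      rw [annihilatingDerivation_linear, mul_comm b a, sub_self, map_zero]
    rw [pow_succ, Module.End.mul_apply, Module.End.mul_apply, ← ih]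
    simp only [Derivation.coeFn_coe, Derivation.leibniz, Derivation.leibniz_pow, h, smul_eq_mul,
      mul_zero, smul_zero, add_zero]

end AnnihilatingDerivation

theorem exists_smul_eq_of_det_eq_zero {K : Type*} [Field K] {a b c e : K}
    (h : b * c - a * e = 0) (hab : (C a * X 0 + C b * X 1 : MvPolynomial (Fin 2) K) ≠ 0) :
    ∃ t : K, (C c * X 0 + C e * X 1 : MvPolynomial (Fin 2) K) = t • (C a * X 0 + C b * X 1) := by
  by_cases ha : a = 0
  · have hb : b ≠ 0 := by
      rintro rfl
      simp [ha] at hab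
    have hc : c = 0 := by simpa [ha, hb] using h
    refine ⟨e / b, ?_⟩
    rw [smul_eq_C_mul, mul_add, ← mul_assoc, ← mul_assoc, ← C_mul, ← C_mul]
    simp [ha, hc, hb]
  · refine ⟨c / a, ?_⟩
    have he : e = c / a * b := by
      field_simp
      linear_combination -h
    rw [smul_eq_C_mul, mul_add, ← mul_assoc, ← mul_assoc, ← C_mul, ← C_mul, ← he,
      div_mul_cancel₀ _ ha]

/-- The spaces of binary forms `l i ^ e i * f i`, with `f i` of degree `n i`, are linearly
independent as soon as each `e j` is at least the total multiplicity `∑ i ≠ j, (n i + 1)` of the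
other points. -/
theorem eq_zero_of_sum_pow_mul_eq_zero {K ι : Type*} [Field K] [CharZero K] [Fintype ι]
    [DecidableEq ι] (l : ι → MvPolynomial (Fin 2) K) (hl : ∀ i, (l i).IsHomogeneous 1)
    (hl0 : ∀ i, l i ≠ 0) (hprop : ∀ i j, i ≠ j → ∀ c : K, l i ≠ c • l j) (e n : ι → ℕ)
    (hen : ∀ j, ∑ i ∈ Finset.univ.erase j, (n i + 1) ≤ e j)
    (f : ι → MvPolynomial (Fin 2) K) (hf : ∀ i, (f i).IsHomogeneous (n i))
    (hsum : ∑ i, l i ^ e i * f i = 0) (j : ι) : f j = 0 := by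
  choose a b hab using fun i ↦ (hl i).exists_eq_X_add_X
  set D : ι → Derivation K (MvPolynomial (Fin 2) K) (MvPolynomial (Fin 2) K) :=
    fun i ↦ annihilatingDerivation (a i) (b i) with hDdef
  set L : List ι := (Finset.univ.erase j).toList.flatMap fun i ↦ List.replicate (n i + 1) i
    with hLdef
  have hlen : L.length = ∑ i ∈ Finset.univ.erase j, (n i + 1) := by
    simp [hLdef, List.length_flatMap, Finset.sum_map_toList]
  have hprod : (L.map fun i ↦ (D i : Module.End K (MvPolynomial (Fin 2) K))).prod =
      ((Finset.univ.erase j).toList.map fun i ↦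
        (D i : Module.End K (MvPolynomial (Fin 2) K)) ^ (n i + 1)).prod := by
    rw [hLdef]
    generalize (Finset.univ.erase j).toList = M
    induction M with
    | nil => rfl
    | cons i M ih => simp [List.flatMap_cons, ih]
  have hkill : ∀ i ≠ j,
      (L.map fun i ↦ (D i : Module.End K (MvPolynomial (Fin 2) K))).prod (l i ^ e i * f i) = 0 := by
    intro i hij
    rw [hprod]
    refine List.prod_apply_eq_zero_of_mem
      (T := (D i : Module.End K (MvPolynomial (Fin 2) K)) ^ (n i + 1))
      (List.mem_map.mpr ⟨i, by simpa using hij, rfl⟩) ?_ ?_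
    · intro S hS
      obtain ⟨i', -, rfl⟩ := List.mem_map.mp hS
      exact (commute_annihilatingDerivation _ _ _ _).pow_pow _ _
    · rw [hab i, annihilatingDerivation_pow_pow_mul,
        (hf i).annihilatingDerivation_pow_apply_eq_zero, mul_zero]
  have hj : (L.map fun i ↦ (D i : Module.End K (MvPolynomial (Fin 2) K))).prod
      (l j ^ e j * f j) = 0 := by
    have h := congrArg
      (L.map fun i ↦ (D i : Module.End K (MvPolynomial (Fin 2) K))).prod hsum
    rwa [map_sum, map_zero, Finset.sum_eq_single j (fun i _ hij ↦ hkill i hij) (by simp)] at h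
  have hunit : ¬IsUnit (l j) := fun h ↦ by
    have h₁ := (hl j).totalDegree (hl0 j)
    rw [(isUnit_iff_totalDegree_of_isReduced.mp h).2] at h₁
    exact zero_ne_one h₁
  have hzero : l j ^ e j * f j = 0 := by
    refine Derivation.eq_zero_of_pow_dvd_of_prod_apply_eq_zero D hunit L ?_
      (Dvd.dvd.mul_right (pow_dvd_pow _ (hlen ▸ hen j)) _) hj
    intro i hi
    have hij : i ≠ j := by
      obtain ⟨i', hi', h⟩ := List.mem_flatMap.mp hi
      rw [List.eq_of_mem_replicate h]
      simpa using hi'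
    refine ⟨b i * a j - a i * b j, fun h ↦ ?_, ?_⟩
    · obtain ⟨t, ht⟩ := exists_smul_eq_of_det_eq_zero h (hab i ▸ hl0 i)
      rw [← hab, ← hab] at ht
      exact hprop j i hij.symm t ht
    · rw [hab j]
      exact annihilatingDerivation_linear _ _ _ _
  exact (mul_eq_zero.mp hzero).resolve_left (pow_ne_zero _ (hl0 j))

theorem finrank_iSup_map_mulLeft_pow {K ι : Type*} [Field K] [CharZero K] [Fintype ι]
    [DecidableEq ι] (l : ι → MvPolynomial (Fin 2) K) (hl : ∀ i, (l i).IsHomogeneous 1)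
    (hl0 : ∀ i, l i ≠ 0) (hprop : ∀ i j, i ≠ j → ∀ c : K, l i ≠ c • l j) (e n : ι → ℕ)
    (hen : ∀ j, ∑ i ∈ Finset.univ.erase j, (n i + 1) ≤ e j) :
    Module.finrank K (⨆ i, (homogeneousSubmodule (Fin 2) K (n i)).map
      (LinearMap.mulLeft K (l i ^ e i)) : Submodule K (MvPolynomial (Fin 2) K)) =
      ∑ i, (n i + 1) := by
  set Φ := LinearMap.lsum K (fun i ↦ homogeneousSubmodule (Fin 2) K (n i)) K
    (fun i ↦ LinearMap.mulLeft K (l i ^ e i) ∘ₗ (homogeneousSubmodule (Fin 2) K (n i)).subtype)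
    with hΦ
  have hrange : (⨆ i, (homogeneousSubmodule (Fin 2) K (n i)).map
      (LinearMap.mulLeft K (l i ^ e i))) = LinearMap.range Φ := by
    apply le_antisymm
    · refine iSup_le fun i ↦ ?_
      rintro _ ⟨q, hq, rfl⟩
      refine ⟨Pi.single i ⟨q, hq⟩, ?_⟩
      rw [hΦ, LinearMap.lsum_piSingle]
      rfl
    · rintro _ ⟨f, rfl⟩
      rw [hΦ, LinearMap.lsum_apply, LinearMap.sum_apply]
      exact Submodule.sum_mem _ fun i _ ↦ Submodule.mem_iSup_of_mem i ⟨f i, (f i).2, rfl⟩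
  have hinj : Function.Injective Φ := by
    rw [← LinearMap.ker_eq_bot, LinearMap.ker_eq_bot']
    intro f hf
    have hsum : ∑ i, l i ^ e i * (f i : MvPolynomial (Fin 2) K) = 0 := by
      simpa [hΦ, LinearMap.lsum_apply] using hf
    ext1 j
    exact Subtype.ext (eq_zero_of_sum_pow_mul_eq_zero l hl hl0 hprop e n hen
      (fun i ↦ f i) (fun i ↦ (f i).2) hsum j)
  have hfin (i : ι) : Module.Finite K (homogeneousSubmodule (Fin 2) K (n i)) :=
    Module.Finite.iff_fg.mpr (homogeneousSubmodule_fg _ _ _)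
  rw [hrange, LinearMap.finrank_range_of_inj hinj, Module.finrank_pi_fintype]
  simp only [finrank_homogeneousSubmodule_fin_two]

theorem homogeneousSubmodule_two_eq_span {K : Type*} [Field K] {p q : MvPolynomial (Fin 2) K}
    (hp : p.IsHomogeneous 1) (hq : q.IsHomogeneous 1) (hp0 : p ≠ 0)
    (hpq : ∀ c : K, q ≠ c • p) :
    homogeneousSubmodule (Fin 2) K 2 = Submodule.span K {X 0 * p, X 1 * p, X 0 * q, X 1 * q} := by
  apply le_antisymm
  · obtain ⟨a, b, rfl⟩ := hp.exists_eq_X_add_X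
    obtain ⟨c, e, rfl⟩ := hq.exists_eq_X_add_X
    have hdet : b * c - a * e ≠ 0 := fun h ↦ by
      obtain ⟨t, ht⟩ := exists_smul_eq_of_det_eq_zero h hp0
      exact hpq t ht
    have hlin : ∀ i : Fin 2, ∃ s t : K, (X i : MvPolynomial (Fin 2) K) =
        s • (C a * X 0 + C b * X 1) + t • (C c * X 0 + C e * X 1) := by
      have key (s t u v : K) (hu : s * a + t * c = u) (hv : s * b + t * e = v) :
          (C u * X 0 + C v * X 1 : MvPolynomial (Fin 2) K) =
          s • (C a * X 0 + C b * X 1) + t • (C c * X 0 + C e * X 1) := by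
        simp only [smul_eq_C_mul, ← hu, ← hv, C_add, C_mul]
        ring
      intro i
      fin_cases i
      · refine ⟨-e / (b * c - a * e), b / (b * c - a * e), ?_⟩
        rw [← key _ _ 1 0
          (by rw [div_mul_eq_mul_div, div_mul_eq_mul_div, ← add_div, div_eq_one_iff_eq hdet]; ring)
          (by field_simp; ring)]
        simp
      · refine ⟨c / (b * c - a * e), -a / (b * c - a * e), ?_⟩
        rw [← key _ _ 0 1 (by field_simp; ring)
          (by rw [div_mul_eq_mul_div, div_mul_eq_mul_div, ← add_div, div_eq_one_iff_eq hdet]; ring)]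
        simp
    rw [← homogeneousSubmodule_one_pow, pow_two, homogeneousSubmodule_one_eq_span_X,
      Submodule.span_mul_span, Submodule.span_le]
    rintro _ ⟨_, ⟨i, rfl⟩, _, ⟨j, rfl⟩, rfl⟩
    obtain ⟨s, t, hst⟩ := hlin j
    have hmul := congrArg (X i * ·) hst
    simp only [mul_add (X i) (_ • _), mul_smul_comm] at hmul
    simp only [SetLike.mem_coe, hmul]
    refine Submodule.add_mem _ (Submodule.smul_mem _ _ (Submodule.subset_span ?_))
      (Submodule.smul_mem _ _ (Submodule.subset_span ?_)) <;> fin_cases i <;> simp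
  · rw [Submodule.span_le]
    have h (i : Fin 2) {r : MvPolynomial (Fin 2) K} (hr : r.IsHomogeneous 1) :
        (X i * r).IsHomogeneous 2 := (isHomogeneous_X K i).mul hr
    rintro _ (rfl | rfl | rfl | rfl)
    exacts [h 0 hp, h 1 hp, h 0 hq, h 1 hq]

theorem map_mulLeft_homogeneousSubmodule_one {K σ : Type*} [CommSemiring K]
    (p : MvPolynomial σ K) :
    (homogeneousSubmodule σ K 1).map (LinearMap.mulLeft K p) =
      Submodule.span K (Set.range fun i ↦ X i * p) := by
  rw [homogeneousSubmodule_one_eq_span_X, Submodule.map_span, ← Set.range_comp]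
  simp [Function.comp_def, mul_comm]

end MvPolynomial

/-- Tangent space computation at a general point of `S_{d,d-k}`: for `d ≥ 2k+2`,
pairwise non-proportional nonzero linear forms `l₀, …, l_k` and a linear form `g`
not proportional to `l₀`, the span of
`{x·l_i^(d-1), y·l_i^(d-1)} ∪ {x·l₀^(d-2)·g, y·l₀^(d-2)·g}` has dimension `2k+3`. -/
theorem tangent_space_dimension {K : Type*} [Field K] [IsAlgClosed K] [CharZero K]
    (d k : ℕ) (hd : 2 * k + 2 ≤ d)
    (l : Fin (k + 1) → MvPolynomial (Fin 2) K)
    (hl : ∀ i, (l i).IsHomogeneous 1) (hl0 : ∀ i, l i ≠ 0)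
    (hprop : ∀ i j, i ≠ j → ∀ c : K, l i ≠ c • l j)
    (g : MvPolynomial (Fin 2) K) (hg : g.IsHomogeneous 1)
    (hgl : ∀ c : K, g ≠ c • l 0 ∧ l 0 ≠ c • g) :
    Module.finrank K (Submodule.span K
      ((Set.range fun p : Fin (k + 1) × Fin 2 => X p.2 * l p.1 ^ (d - 1)) ∪
        {X 0 * l 0 ^ (d - 2) * g, X 1 * l 0 ^ (d - 2) * g})) = 2 * k + 3 := by
  set n : Fin (k + 1) → ℕ := fun i ↦ if i = 0 then 2 else 1 with hn
  have htotal : ∑ i, (n i + 1) = 2 * k + 3 := by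
    simp [Fin.sum_univ_succ, hn]
    ring
  have hen : ∀ j, ∑ i ∈ Finset.univ.erase j, (n i + 1) ≤ d - n j := by
    intro j
    have h := Finset.add_sum_erase Finset.univ (fun i ↦ n i + 1) (Finset.mem_univ j)
    omega
  have hpow : l 0 ^ (d - 1) = l 0 ^ (d - 2) * l 0 := by
    rw [← pow_succ]
    congr 1
    omega
  have hquad : (homogeneousSubmodule (Fin 2) K (n 0)).map (LinearMap.mulLeft K (l 0 ^ (d - n 0))) =
      Submodule.span K {X 0 * l 0 ^ (d - 1), X 1 * l 0 ^ (d - 1),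
        X 0 * l 0 ^ (d - 2) * g, X 1 * l 0 ^ (d - 2) * g} := by
    simp only [hn, if_true]
    rw [homogeneousSubmodule_two_eq_span (hl 0) hg (hl0 0) fun c ↦ (hgl c).1, Submodule.map_span]
    simp only [Set.image_insert_eq, Set.image_singleton, LinearMap.mulLeft_apply, hpow]
    simp only [mul_left_comm _ (X _), mul_assoc]
  have hlin (i : Fin (k + 1)) (hi : i ≠ 0) :
      (homogeneousSubmodule (Fin 2) K (n i)).map (LinearMap.mulLeft K (l i ^ (d - n i))) =
      Submodule.span K (Set.range fun m : Fin 2 ↦ X m * l i ^ (d - 1)) := by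
    simp only [hn, if_neg hi]
    exact map_mulLeft_homogeneousSubmodule_one _
  rw [← htotal, ← finrank_iSup_map_mulLeft_pow l hl hl0 hprop (fun i ↦ d - n i) n hen]
  refine congrArg (fun S : Submodule K (MvPolynomial (Fin 2) K) ↦ Module.finrank K S) ?_
  apply le_antisymm
  · rw [Submodule.span_le]
    rintro _ (⟨⟨i, m⟩, rfl⟩ | hq)
    · refine Submodule.mem_iSup_of_mem i ?_
      by_cases hi : i = 0
      · subst hi
        rw [hquad]
        refine Submodule.subset_span ?_
        fin_cases m <;> simp
      · rw [hlin i hi]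
        exact Submodule.subset_span ⟨m, rfl⟩
    · refine Submodule.mem_iSup_of_mem 0 ?_
      rw [hquad]
      exact Submodule.subset_span (Or.inr (Or.inr hq))
  · refine iSup_le fun i ↦ ?_
    by_cases hi : i = 0
    · subst hi
      rw [hquad]
      refine Submodule.span_mono ?_
      rintro _ (rfl | rfl | hq)
      exacts [Or.inl ⟨(0, 0), rfl⟩, Or.inl ⟨(0, 1), rfl⟩, Or.inr hq]
    · rw [hlin i hi]
      refine Submodule.span_mono ?_
      rintro _ ⟨m, rfl⟩
      exact Or.inl ⟨(i, m), rfl⟩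
end

section
/- Let d and k be integers with d ≥ 2k+1 and k ≥ 0, and let l₀, l₁, …, l_k ∈ K[x,y] be pairwise non-proportional nonzero linear forms. Then the K-vector space spanned by the binary forms { x·l_i^{d−1}, y·l_i^{d−1} : 0 ≤ i ≤ k } inside the space of degree-d binary forms has dimension exactly 2(k+1). -/
open MvPolynomial

/-- The binary linear form `v 0 * x + v 1 * y`. -/
noncomputable def binaryLinearForm {K : Type*} [CommSemiring K] (v : Fin 2 → K) :
    MvPolynomial (Fin 2) K :=
  C (v 0) * X 0 + C (v 1) * X 1

/-- The derivation `w 0 * ∂/∂x + w 1 * ∂/∂y` of `K[x, y]`. -/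
noncomputable def directionalDerivation {K : Type*} [CommSemiring K] (w : Fin 2 → K) :
    Derivation K (MvPolynomial (Fin 2) K) (MvPolynomial (Fin 2) K) :=
  mkDerivation K fun i => C (w i)

theorem directionalDerivation_binaryLinearForm {K : Type*} [CommSemiring K] (w v : Fin 2 → K) :
    directionalDerivation w (binaryLinearForm v) = C (v 0 * w 0 + v 1 * w 1) := by
  simp [directionalDerivation, binaryLinearForm, Derivation.leibniz, mkDerivation_X]

theorem coeff_binaryLinearForm {K : Type*} [CommSemiring K] (v : Fin 2 → K) (i : Fin 2) :
    coeff (Finsupp.single i 1) (binaryLinearForm v) = v i := by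
  fin_cases i <;> simp [binaryLinearForm, coeff_C_mul, coeff_X, Finsupp.single_left_inj]

theorem binaryLinearForm_eq_zero_iff {K : Type*} [CommSemiring K] {v : Fin 2 → K} :
    binaryLinearForm v = 0 ↔ v = 0 := by
  constructor
  · intro h
    ext i
    rw [← coeff_binaryLinearForm v i, h, coeff_zero, Pi.zero_apply]
  · rintro rfl
    simp [binaryLinearForm]

theorem MvPolynomial.IsHomogeneous.exists_eq_binaryLinearForm {K : Type*} [CommSemiring K]
    {p : MvPolynomial (Fin 2) K} (hp : p.IsHomogeneous 1) :
    ∃ v : Fin 2 → K, p = binaryLinearForm v := by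
  rw [← mem_homogeneousSubmodule, homogeneousSubmodule_one_eq_span_X,
    Submodule.mem_span_range_iff_exists_fun] at hp
  obtain ⟨v, rfl⟩ := hp
  exact ⟨v, by simp [binaryLinearForm, Fin.sum_univ_two, smul_eq_C_mul]⟩

/-- The second directional derivative of `m * l ^ (e + 2)` for linear forms `m` and `l`. -/
theorem directionalDerivation_iterate_mul_pow {K : Type*} [CommRing K] (w u v : Fin 2 → K)
    (e : ℕ) :
    directionalDerivation w (directionalDerivation w
      (binaryLinearForm u * binaryLinearForm v ^ (e + 2))) =
    binaryLinearForm (fun j =>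
      2 * (e + 2) * (u 0 * w 0 + u 1 * w 1) * (v 0 * w 0 + v 1 * w 1) * v j +
      (e + 2) * (e + 1) * (v 0 * w 0 + v 1 * w 1) ^ 2 * u j) * binaryLinearForm v ^ e := by
  have hC (c : K) : directionalDerivation w (C c) = 0 := (directionalDerivation w).map_algebraMap c
  have hn (n : ℕ) : directionalDerivation w (n : MvPolynomial (Fin 2) K) = 0 :=
    (directionalDerivation w).map_natCast n
  simp only [Derivation.leibniz, Derivation.leibniz_pow, map_add, smul_eq_mul, nsmul_eq_mul,
    directionalDerivation_binaryLinearForm, hC, hn, Nat.add_sub_cancel,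
    show e + 2 - 1 = e + 1 from rfl]
  simp only [binaryLinearForm, map_add, map_mul, map_pow, map_natCast, map_ofNat, map_one]
  push_cast
  ring

/-- If `v j` are pairwise non-proportional, then powers of the associated linear forms are
independent over the linear forms, up to twice the number of forms minus two. -/
theorem eq_zero_of_sum_binaryLinearForm_mul_pow_eq_zero {K ι : Type*} [Field K] [CharZero K]
    [DecidableEq ι] (v : ι → Fin 2 → K) (s : Finset ι) (hv0 : ∀ i ∈ s, v i ≠ 0)
    (hv : ∀ i ∈ s, ∀ j ∈ s, i ≠ j → v i 0 * v j 1 - v i 1 * v j 0 ≠ 0)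
    (e : ℕ) (he : 2 * s.card ≤ e + 2) (u : ι → Fin 2 → K)
    (h : ∑ i ∈ s, binaryLinearForm (u i) * binaryLinearForm (v i) ^ e = 0) :
    ∀ i ∈ s, u i = 0 := by
  induction s using Finset.induction_on generalizing e u with
  | empty => simp
  | insert j s hj ih =>
    rw [Finset.card_insert_of_notMem hj] at he
    rw [Finset.sum_insert hj] at h
    have hs : ∀ i ∈ s, u i = 0 := by
      rcases s.eq_empty_or_nonempty with rfl | hne
      · simp
      have := hne.card_pos
      obtain ⟨f, rfl⟩ : ∃ f, e = f + 2 := ⟨e - 2, by omega⟩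
      have hD := congrArg (fun p => directionalDerivation ![v j 1, -v j 0]
        (directionalDerivation ![v j 1, -v j 0] p)) h
      have hc : v j 0 * v j 1 + v j 1 * -v j 0 = 0 := by ring
      simp only [map_add, map_sum, map_zero, directionalDerivation_iterate_mul_pow,
        Matrix.cons_val_zero, Matrix.cons_val_one, hc] at hD
      simp only [mul_zero, zero_mul, ne_eq, OfNat.ofNat_ne_zero, not_false_eq_true, zero_pow,
        add_zero] at hD
      rw [binaryLinearForm_eq_zero_iff.2 (Pi.zero_def ..).symm, zero_mul, zero_add] at hD
      have key := ih (fun i hi => hv0 i (Finset.mem_insert_of_mem hi))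
        (fun i hi k hk => hv i (Finset.mem_insert_of_mem hi) k (Finset.mem_insert_of_mem hk))
        f (by omega) _ hD
      intro i hi
      have hci := hv i (Finset.mem_insert_of_mem hi) j (Finset.mem_insert_self j s)
        (fun hij => hj (hij ▸ hi))
      have hk0 := congrFun (key i hi) 0
      have hk1 := congrFun (key i hi) 1
      simp only [Pi.zero_apply] at hk0 hk1
      have f1 : (f : K) + 1 ≠ 0 := by exact_mod_cast f.succ_ne_zero
      have f2 : (f : K) + 2 ≠ 0 := by exact_mod_cast (f + 1).succ_ne_zero
      have f3 : (f : K) + 3 ≠ 0 := by exact_mod_cast (f + 2).succ_ne_zero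
      set c := v i 0 * v j 1 - v i 1 * v j 0 with hcdef
      have hcu : u i 0 * v j 1 + u i 1 * -v j 0 = 0 := by
        have : ((f : K) + 2) * (f + 3) * c ^ 2 * (u i 0 * v j 1 + u i 1 * -v j 0) = 0 := by
          rw [hcdef]
          linear_combination v j 1 * hk0 - v j 0 * hk1
        simpa [f2, f3, hci] using this
      have hcv : v i 0 * v j 1 + v i 1 * -v j 0 = c := by rw [hcdef]; ring
      rw [hcu, hcv] at hk0 hk1
      ext t
      fin_cases t
      · simpa [f1, f2, hci] using hk0
      · simpa [f1, f2, hci] using hk1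
    intro i hi
    rcases Finset.mem_insert.1 hi with rfl | hi
    · rw [Finset.sum_eq_zero (fun k hk => by
        rw [hs k hk, binaryLinearForm_eq_zero_iff.2 rfl, zero_mul]), add_zero] at h
      have hvi : binaryLinearForm (v i) ≠ 0 :=
        fun h0 => hv0 i hi (binaryLinearForm_eq_zero_iff.1 h0)
      exact binaryLinearForm_eq_zero_iff.1 ((mul_eq_zero.1 h).resolve_right (pow_ne_zero e hvi))
    · exact hs i hi

theorem exists_eq_smul_of_det_eq_zero {K : Type*} [Field K] {v w : Fin 2 → K} (hw : w ≠ 0)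
    (h : v 0 * w 1 - v 1 * w 0 = 0) : ∃ c : K, v = c • w := by
  by_cases h0 : w 0 = 0
  · have h1 : w 1 ≠ 0 := fun h1 => hw (by ext t; fin_cases t <;> assumption)
    refine ⟨v 1 / w 1, ?_⟩
    ext t
    fin_cases t
    · simpa [h0, h1] using h
    · simp [h1]
  · refine ⟨v 0 / w 0, ?_⟩
    ext t
    fin_cases t
    · simp [h0]
    · simp only [Fin.mk_one, Pi.smul_apply, smul_eq_mul]
      field_simp
      linear_combination -h

/-- For `d ≥ 2k+1` and pairwise non-proportional nonzero linear forms `l₀, …, l_k`,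
the span of `{x·l_i^(d-1), y·l_i^(d-1) : 0 ≤ i ≤ k}` has dimension exactly `2(k+1)`. -/
theorem span_tangent_lines_dim {K : Type*} [Field K] [IsAlgClosed K] [CharZero K]
    (d k : ℕ) (hd : 2 * k + 1 ≤ d)
    (l : Fin (k + 1) → MvPolynomial (Fin 2) K)
    (hl : ∀ i, (l i).IsHomogeneous 1) (hl0 : ∀ i, l i ≠ 0)
    (hprop : ∀ i j, i ≠ j → ∀ c : K, l i ≠ c • l j) :
    Module.finrank K (Submodule.span K
      (Set.range fun p : Fin (k + 1) × Fin 2 => X p.2 * l p.1 ^ (d - 1))) =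
      2 * (k + 1) := by
  choose v hv using fun i => (hl i).exists_eq_binaryLinearForm
  obtain rfl : l = fun i => binaryLinearForm (v i) := funext hv
  have hv0 : ∀ i, v i ≠ 0 := fun i h => hl0 i (binaryLinearForm_eq_zero_iff.2 h)
  have hdet : ∀ i j, i ≠ j → v i 0 * v j 1 - v i 1 * v j 0 ≠ 0 := by
    intro i j hij h
    obtain ⟨c, hc⟩ := exists_eq_smul_of_det_eq_zero (hv0 j) h
    refine hprop i j hij c ?_
    simp only [hc, binaryLinearForm, Pi.smul_apply, smul_eq_mul, map_mul, smul_eq_C_mul]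
    ring
  have hli : LinearIndependent K fun p : Fin (k + 1) × Fin 2 =>
      (X p.2 * binaryLinearForm (v p.1) ^ (d - 1) : MvPolynomial (Fin 2) K) := by
    rw [Fintype.linearIndependent_iff]
    intro g hg
    have := eq_zero_of_sum_binaryLinearForm_mul_pow_eq_zero v Finset.univ (fun i _ => hv0 i)
      (fun i _ j _ => hdet i j) (d - 1) (by simp; omega) (fun i t => g (i, t)) (by
        rw [← hg, Fintype.sum_prod_type]
        refine Finset.sum_congr rfl fun i _ => ?_
        simp only [Fin.sum_univ_two, binaryLinearForm, smul_eq_C_mul]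
        ring)
    exact fun p => congrFun (this p.1 (Finset.mem_univ _)) p.2
  rw [finrank_span_eq_card hli]
  simp [mul_comm]
end

section
/- Let d ≥ 2 and 0 ≤ k ≤ d−1. Let l₀, g ∈ K[x,y] be non-proportional nonzero linear forms and let l₁, …, l_k be arbitrary linear forms. Then the binary form f = l₀^{d−1}·g + l₁^d + ⋯ + l_k^d is nonzero and has Waring rank rk(f) ≥ d − k. -/
open MvPolynomial

/-- A bivariate homogeneous polynomial of degree one is `a X + b Y`. -/
theorem MvPolynomial.IsHomogeneous.exists_eq_linear_fin_two {K : Type*} [CommRing K]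
    {m : MvPolynomial (Fin 2) K} (hm : m.IsHomogeneous 1) :
    ∃ a b : K, m = C a * X 0 + C b * X 1 := by
  have h := (Submodule.mem_span_range_iff_exists_fun K).1
    (homogeneousSubmodule_one_eq_span_X (σ := Fin 2) (R := K) ▸
      (mem_homogeneousSubmodule 1 m).2 hm)
  obtain ⟨c, hc⟩ := h
  exact ⟨c 0, c 1, by simp [← hc, Fin.sum_univ_two, smul_eq_C_mul]⟩

/-- A linear form which is not a multiple of the linear form `l₀` is killed by a derivation that
does not kill `l₀` and maps linear forms to constants. -/
theorem exists_derivation_or_eq_smul {K : Type*} [Field K] {l₀ m : MvPolynomial (Fin 2) K}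
    (hl₀ : l₀.IsHomogeneous 1) (hl₀0 : l₀ ≠ 0) (hm : m.IsHomogeneous 1) :
    (∃ c : K, m = c • l₀) ∨
      ∃ D : Derivation K (MvPolynomial (Fin 2) K) (MvPolynomial (Fin 2) K),
        D m = 0 ∧ (∃ u : K, u ≠ 0 ∧ D l₀ = C u) ∧
          ∀ n : MvPolynomial (Fin 2) K, n.IsHomogeneous 1 → ∃ v : K, D n = C v := by
  obtain ⟨a, b, rfl⟩ := hm.exists_eq_linear_fin_two
  obtain ⟨p, q, rfl⟩ := hl₀.exists_eq_linear_fin_two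
  have key (p q : K) : (b • pderiv 0 - a • pderiv 1 :
      Derivation K (MvPolynomial (Fin 2) K) (MvPolynomial (Fin 2) K))
        (C p * X 0 + C q * X 1) = C (b * p - a * q) := by
    simp [pderiv_X, smul_eq_C_mul]
  by_cases h : b * p - a * q = 0
  · left
    by_cases hp : p = 0
    · have hq : q ≠ 0 := by
        rintro rfl
        simp [hp] at hl₀0
      have ha : a = 0 := by simpa [hp, hq] using h
      exact ⟨b / q, by
        rw [smul_add, smul_eq_C_mul, smul_eq_C_mul, ← mul_assoc, ← mul_assoc, ← C_mul, ← C_mul]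
        simp [hp, ha, hq]⟩
    · refine ⟨a / p, ?_⟩
      have hb : a / p * q = b := by field_simp; linear_combination -h
      rw [smul_add, smul_eq_C_mul, smul_eq_C_mul, ← mul_assoc, ← mul_assoc, ← C_mul, ← C_mul,
        hb, div_mul_cancel₀ _ hp]
  · refine .inr ⟨_, ?_, ⟨_, h, key p q⟩, fun n hn ↦ ?_⟩
    · rw [key, mul_comm, sub_self, C_0]
    · obtain ⟨p', q', rfl⟩ := hn.exists_eq_linear_fin_two
      exact ⟨_, key p' q'⟩

/-- If `α l₀^e g + β l₀^(e+1)` is a linear combination of at most `e` powers of linear forms,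
then `α = 0`. -/
theorem eq_zero_of_eq_sum_pow {K ι : Type*} [Field K] [CharZero K]
    {l₀ g : MvPolynomial (Fin 2) K} (hl₀ : l₀.IsHomogeneous 1) (hg : g.IsHomogeneous 1)
    (hl₀0 : l₀ ≠ 0) (hprop : ∀ c : K, g ≠ c • l₀)
    (m : ι → MvPolynomial (Fin 2) K) (hm : ∀ i, (m i).IsHomogeneous 1) (s : Finset ι) :
    ∀ (e : ℕ) (_ : s.card ≤ e) (α β : K) (c : ι → K)
      (_ : C α * l₀ ^ e * g + C β * l₀ ^ (e + 1) = ∑ i ∈ s, C (c i) * m i ^ (e + 1)), α = 0 := by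
  classical
  induction s using Finset.induction_on with
  | empty =>
    intro e _ α β c h
    have h' : l₀ ^ e * (C α * g + C β * l₀) = 0 := by
      rw [Finset.sum_empty] at h
      linear_combination h
    have h0 := (mul_eq_zero.1 h').resolve_left (pow_ne_zero _ hl₀0)
    by_contra hα
    refine hprop (-(β / α)) ?_
    have hC : (C α⁻¹ * C α : MvPolynomial (Fin 2) K) = 1 := by
      rw [← C_mul, inv_mul_cancel₀ hα, C_1]
    rw [smul_eq_C_mul, div_eq_mul_inv, C_neg, C_mul]
    linear_combination C α⁻¹ * h0 - g * hC
  | insert i s hi ih =>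
    intro e he α β c h
    rw [Finset.card_insert_of_notMem hi] at he
    rw [Finset.sum_insert hi] at h
    rcases exists_derivation_or_eq_smul hl₀ hl₀0 (hm i) with ⟨t, ht⟩ | ⟨D, hD, ⟨u, hu, hDl⟩, hDn⟩
    · refine ih e (by omega) α (β - c i * t ^ (e + 1)) c ?_
      rw [ht, smul_eq_C_mul] at h
      rw [C_sub, C_mul, C_pow]
      linear_combination h
    · obtain ⟨n, rfl⟩ : ∃ n, e = n + 1 := ⟨e - 1, by omega⟩
      obtain ⟨v, hv⟩ := hDn g hg
      choose w hw using fun j ↦ hDn (m j) (hm j)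
      have hCD (a : K) : D (C a) = 0 := D.map_algebraMap a
      have h2 := congrArg D h
      simp only [map_add, map_sum, Derivation.leibniz, Derivation.leibniz_pow, hCD, hD, hDl, hv,
        hw, smul_eq_mul, nsmul_eq_mul, mul_zero, add_zero, zero_add, add_tsub_cancel_right] at h2
      have h3 := ih n (by omega) (α * ((n + 1 : ℕ) * u)) (α * v + β * ((n + 2 : ℕ) * u))
        (fun j ↦ c j * ((n + 2 : ℕ) * w j)) (by
          rw [show ∑ j ∈ s, C (c j * ((n + 2 : ℕ) * w j)) * m j ^ (n + 1) =
            ∑ j ∈ s, C (c j) * (((n + 1 + 1 : ℕ) : MvPolynomial (Fin 2) K) *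
              (m j ^ (n + 1) * C (w j))) from Finset.sum_congr rfl fun j _ ↦ by
                simp only [C_mul, map_natCast]; ring, ← h2]
          simp only [C_mul, C_add, map_natCast]
          push_cast
          ring)
      have hn : ((n + 1 : ℕ) : K) ≠ 0 := Nat.cast_ne_zero.2 n.succ_ne_zero
      exact (mul_eq_zero.1 h3).resolve_right (mul_ne_zero hn hu)

/-- Over a field of characteristic zero, `x ^ (d - 1) * y` is a linear
combination of the powers `(x + t y) ^ d` with `t = 0, …, d`. -/
theorem exists_pow_mul_eq_sum_smul_pow {K A : Type*} [Field K] [CharZero K] [CommRing A]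
    [Algebra K A] {d : ℕ} (hd : 1 ≤ d) (x y : A) :
    ∃ c : Fin (d + 1) → K,
      x ^ (d - 1) * y = ∑ j, c j • (x + ((j : ℕ) : K) • y) ^ d := by
  have hV : IsUnit (Matrix.vandermonde fun j : Fin (d + 1) ↦ ((j : ℕ) : K)) := by
    rw [Matrix.isUnit_iff_isUnit_det, isUnit_iff_ne_zero, Matrix.det_vandermonde_ne_zero_iff]
    exact fun i j h ↦ Fin.ext (Nat.cast_injective h)
  obtain ⟨c, hc⟩ := Matrix.vecMul_surjective_iff_isUnit.2 hV
    (Pi.single ⟨1, by omega⟩ ((d : K)⁻¹))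
  have hc' (i : ℕ) (hi : i < d + 1) :
      ∑ j : Fin (d + 1), c j * ((j : ℕ) : K) ^ i = if i = 1 then (d : K)⁻¹ else 0 := by
    have := congrFun hc ⟨i, hi⟩
    simpa [Matrix.vecMul, dotProduct, Matrix.vandermonde_apply, Pi.single_apply] using this
  have hd0 : (d : K) ≠ 0 := Nat.cast_ne_zero.2 (by omega)
  refine ⟨c, ?_⟩
  have hexp (j : Fin (d + 1)) : c j • (x + ((j : ℕ) : K) • y) ^ d =
      ∑ i ∈ Finset.range (d + 1),
        (c j * ((j : ℕ) : K) ^ i) • (y ^ i * x ^ (d - i) * (d.choose i : A)) := by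
    rw [add_comm x, add_pow, Finset.smul_sum]
    refine Finset.sum_congr rfl fun i _ ↦ ?_
    rw [smul_pow, smul_mul_assoc, smul_mul_assoc, smul_smul]
  simp_rw [hexp]
  rw [Finset.sum_comm]
  simp_rw [← Finset.sum_smul]
  rw [Finset.sum_eq_single 1]
  · rw [hc' 1 (by omega), if_pos rfl, Nat.choose_one_right, pow_one, ← nsmul_eq_mul',
      ← Nat.cast_smul_eq_nsmul K, smul_smul, inv_mul_cancel₀ hd0, one_smul, mul_comm]
  · intro i hi hi1
    rw [hc' i (Finset.mem_range.1 hi), if_neg hi1, zero_smul]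
  · intro h
    exact absurd (Finset.mem_range.2 (by omega)) h

/-- For `d ≥ 2`, `0 ≤ k ≤ d-1`, non-proportional nonzero linear forms `l₀, g` and
arbitrary (possibly zero) linear forms `l₁, …, l_k`, the binary form
`f = l₀^(d-1)·g + l₁^d + ⋯ + l_k^d` is nonzero and has Waring rank at least `d - k`. -/
theorem rank_lower_bound {K : Type*} [Field K] [IsAlgClosed K] [CharZero K]
    (d k : ℕ) (hd : 2 ≤ d) (hk : k ≤ d - 1)
    (l₀ g : MvPolynomial (Fin 2) K)
    (hl₀ : l₀.IsHomogeneous 1) (hg : g.IsHomogeneous 1)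
    (hl₀0 : l₀ ≠ 0) (hg0 : g ≠ 0)
    (hprop : ∀ c : K, g ≠ c • l₀ ∧ l₀ ≠ c • g)
    (l : Fin k → MvPolynomial (Fin 2) K) (hl : ∀ i, (l i).IsHomogeneous 1) :
    l₀ ^ (d - 1) * g + ∑ i, l i ^ d ≠ 0 ∧
      d - k ≤ waringRank K d (l₀ ^ (d - 1) * g + ∑ i, l i ^ d) := by
  have key (r : ℕ) (m : Fin r → MvPolynomial (Fin 2) K) (hm : ∀ i, (m i).IsHomogeneous 1)
      (h : l₀ ^ (d - 1) * g + ∑ i, l i ^ d = ∑ i, m i ^ d) : d - k ≤ r := by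
    by_contra! hr
    refine one_ne_zero (eq_zero_of_eq_sum_pow hl₀ hg hl₀0 (fun c ↦ (hprop c).1) (Sum.elim m l)
      (Sum.rec hm hl) Finset.univ (d - 1) ?_ (1 : K) 0 (Sum.elim (fun _ ↦ 1) (fun _ ↦ -1)) ?_)
    · simp only [Finset.card_univ, Fintype.card_sum, Fintype.card_fin]
      omega
    · rw [Nat.sub_add_cancel (by omega : 1 ≤ d)]
      simp only [Fintype.sum_sum_type, Sum.elim_inl, Sum.elim_inr, C_1, C_0, C_neg, one_mul,
        zero_mul, neg_mul, add_zero, Finset.sum_neg_distrib]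
      linear_combination h
  refine ⟨fun h ↦ ?_, le_csInf ?_ ?_⟩
  · have := key 0 Fin.elim0 (fun i ↦ i.elim0) (by simpa using h)
    omega
  · obtain ⟨c, hc⟩ := exists_pow_mul_eq_sum_smul_pow (K := K) (by omega : 1 ≤ d) l₀ g
    choose z hz using fun j ↦ IsAlgClosed.exists_pow_nat_eq (c j) (by omega : 0 < d)
    let p : Fin (d + 1) ⊕ Fin k → MvPolynomial (Fin 2) K :=
      Sum.elim (fun j ↦ z j • (l₀ + ((j : ℕ) : K) • g)) l
    have hp : ∀ i, (p i).IsHomogeneous 1 := by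
      rintro (j | i)
      · exact (homogeneousSubmodule (Fin 2) K 1).smul_mem _ (add_mem hl₀
          ((homogeneousSubmodule (Fin 2) K 1).smul_mem _ hg))
      · exact hl i
    refine ⟨_, p ∘ (Fintype.equivFin _).symm, fun i ↦ hp _, ?_⟩
    simp only [Function.comp_apply]
    rw [Equiv.sum_comp (Fintype.equivFin (Fin (d + 1) ⊕ Fin k)).symm fun i ↦ p i ^ d,
      Fintype.sum_sum_type, hc]
    simp only [p, Sum.elim_inl, Sum.elim_inr, smul_pow, hz]
  · rintro r ⟨m, hm, h⟩
    exact key r m hm h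
end
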